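/- arXiv:2506.12458 — 3 statements merged into one kernel-verified Lean document; each statement's English description precedes it below -/
import Mathlib

section
/- Let α be a finite ordinal, A a finitary polyadic algebra of dimension α (satisfying (F0)–(F9)), U a set, and g : A → Sb(^αU) a map that preserves intersection (g(x·y) = g(x) ∩ g(y)), complementation (g(−x) = ^αU − g(x)), and cylindrification (g(c_i x) = C_i g(x)). Then for all i,j < α: (a) if g(x) = ∅ then g(s_ij x) = ∅; and consequently (b) for all a,b ∈ A, if g(a) = g(b) then g(s_ij a) = g(s_ij b). -/
/-- Cylindrification `C_i` on α-ary relations over `U`. -/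
def Cyl {n : ℕ} {U : Type} (i : Fin n) (X : Set (Fin n → U)) : Set (Fin n → U) :=
  {s | ∃ u : U, Function.update s i u ∈ X}

/-- Substitution `S_ij` on α-ary relations over `U`. -/
def Subst {n : ℕ} {U : Type} (i j : Fin n) (X : Set (Fin n → U)) : Set (Fin n → U) :=
  {s | Function.update s i (s j) ∈ X}

/-- Transposition `P_ij` on α-ary relations over `U`. -/
def Transp {n : ℕ} {U : Type} (i j : Fin n) (X : Set (Fin n → U)) : Set (Fin n → U) :=
  {s | Function.update (Function.update s i (s j)) j (s i) ∈ X}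

/-- A finitary polyadic algebra of dimension `n`: a Boolean algebra `A` equipped with
operations `c_i`, `s_ij`, `p_ij` satisfying (F0)–(F9). -/
structure FPA (n : ℕ) (A : Type) [BooleanAlgebra A] where
  c : Fin n → A → A
  s : Fin n → Fin n → A → A
  p : Fin n → Fin n → A → A
  F0s : ∀ i x, s i i x = x
  F0p : ∀ i x, p i i x = x
  F0psym : ∀ i j, p i j = p j i
  F1 : ∀ i x, x ≤ c i x
  F2 : ∀ i x y, c i (x ⊔ y) = c i x ⊔ c i y
  F3 : ∀ i j x, s i j (c i x) = c i x
  F4 : ∀ i j x, i ≠ j → c i (s i j x) = s i j x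
  F5 : ∀ i j k x, k ≠ i → k ≠ j → s i j (c k x) = c k (s i j x)
  F6s_meet : ∀ i j x y, s i j (x ⊓ y) = s i j x ⊓ s i j y
  F6s_compl : ∀ i j x, s i j xᶜ = (s i j x)ᶜ
  F6p_meet : ∀ i j x y, p i j (x ⊓ y) = p i j x ⊓ p i j y
  F6p_compl : ∀ i j x, p i j xᶜ = (p i j x)ᶜ
  F7 : ∀ i j x, p i j (p i j x) = x
  F8 : ∀ i j k x, i ≠ j → i ≠ k → j ≠ k → p i j (p i k x) = p j k (p i j x)
  F9 : ∀ i j x, p i j (s j i x) = s i j x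

/-- If `g` preserves intersection, complementation and cylindrification, then
(a) `g x = ∅` implies `g (s_ij x) = ∅`, and consequently
(b) `g a = g b` implies `g (s_ij a) = g (s_ij b)`. -/
theorem subst_image_well_defined
    (n : ℕ) (A : Type) [BooleanAlgebra A] (F : FPA n A)
    (U : Type) (g : A → Set (Fin n → U))
    (hgmeet : ∀ x y, g (x ⊓ y) = g x ∩ g y)
    (hgcompl : ∀ x, g xᶜ = (g x)ᶜ)
    (hgc : ∀ i x, g (F.c i x) = Cyl i (g x)) :
    (∀ (i j : Fin n) (x : A), g x = ∅ → g (F.s i j x) = ∅) ∧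
    (∀ (i j : Fin n) (a b : A), g a = g b → g (F.s i j a) = g (F.s i j b)) := by
  have ha : ∀ (i j : Fin n) (x : A), g x = ∅ → g (F.s i j x) = ∅ := by
    intro i j x hx
    have h1 : F.s i j x ⊓ F.c i x = F.s i j x := by
      conv_lhs => rw [← F.F3 i j x, ← F.F6s_meet, inf_eq_left.mpr (F.F1 i x)]
    rw [← h1, hgmeet, hgc, hx]
    ext t
    simp [Cyl]
  have hb : ∀ (i j : Fin n) (a b : A), g a = g b → g (F.s i j a) ⊆ g (F.s i j b) := by
    intro i j a b hab
    have h := ha i j (a ⊓ bᶜ) (by rw [hgmeet, hgcompl, hab, Set.inter_compl_self])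
    rw [F.F6s_meet, F.F6s_compl, hgmeet, hgcompl] at h
    intro t ht
    by_contra hn
    have hmem : t ∈ g (F.s i j a) ∩ (g (F.s i j b))ᶜ := ⟨ht, hn⟩
    rw [h] at hmem
    exact hmem
  exact ⟨ha, fun i j a b hab => Set.Subset.antisymm (hb i j a b hab) (hb i j b a hab.symm)⟩
end

section
/- (Claim 1) Let α be a finite ordinal, U a set, H a set with |H| > α, V = U×H, and W = {s ∈ ^αV : s_i ≠ s_j for all i < j < α} the set of repetition-free sequences. For s ∈ ^αV let ŝ ∈ ^αU be the sequence of first coordinates ⟨s_i(0) : i < α⟩. Let A be an algebra of type ⟨A,·,−,c_i,p_ij⟩ and f : A → Sb(^αU) a homomorphism into the full cp set algebra (f preserves ∩, complement, C_i, P_ij). Define g(x) = {s ∈ W : ŝ ∈ f(x)}. Then g is a homomorphism into ⟨Sb(W), ∩, relative complement in W, C_i^W, P_ij⟩, where C_i^W(X) = W ∩ C_i^V(X): that is, g(x·y) = g(x) ∩ g(y), g(−x) = W − g(x), g(c_i x) = C_i^W g(x), and g(p_ij x) = P_ij g(x) for all i,j < α. -/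
theorem hat_update {n : ℕ} {U H : Type} (s : Fin n → U × H) (i : Fin n) (v : U × H) :
    (fun k => (Function.update s i v k).1) = Function.update (fun k => (s k).1) i v.1 := by
  funext k
  by_cases h : k = i
  · subst h; simp
  · simp [h]

theorem update_eq_swap {n : ℕ} {V : Type} (s : Fin n → V) (i j : Fin n) :
    Function.update (Function.update s i (s j)) j (s i) = s ∘ Equiv.swap i j := by
  funext k
  by_cases h : k = j
  · subst h; simp
  · by_cases h' : k = i
    · subst h'; simp [h]
    · simp [h, h', Equiv.swap_apply_of_ne_of_ne h' h]

theorem injective_update {n : ℕ} {V : Type} (s : Fin n → V) (hs : Function.Injective s)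
    (i : Fin n) (v : V) (hv : ∀ k, s k ≠ v) : Function.Injective (Function.update s i v) := by
  intro a b hab
  by_cases ha : a = i <;> by_cases hb : b = i
  · rw [ha, hb]
  · subst ha; simp [hb] at hab; exact absurd hab.symm (hv b)
  · subst hb; simp [ha] at hab; exact absurd hab (hv a)
  · simp [ha, hb] at hab; exact hs hab

/-- Claim 1: `g x = {s ∈ W : ŝ ∈ f x}` is a homomorphism into the relativized
cp set algebra on the repetition-free sequences `W ⊆ ^α(U × H)`. -/
theorem claim1
    (n : ℕ) (U H : Type) (hH : (n : Cardinal) < Cardinal.mk H)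
    (A : Type) [BooleanAlgebra A]
    (c : Fin n → A → A) (p : Fin n → Fin n → A → A)
    (f : A → Set (Fin n → U))
    (hfmeet : ∀ x y, f (x ⊓ y) = f x ∩ f y)
    (hfcompl : ∀ x, f xᶜ = (f x)ᶜ)
    (hfc : ∀ i x, f (c i x) = Cyl i (f x))
    (hfp : ∀ i j x, f (p i j x) = Transp i j (f x))
    (W : Set (Fin n → U × H)) (hW : W = {s | Function.Injective s})
    (g : A → Set (Fin n → U × H))
    (hg : ∀ x, g x = {s | s ∈ W ∧ (fun i => (s i).1) ∈ f x}) :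
    (∀ x y, g (x ⊓ y) = g x ∩ g y) ∧
    (∀ x, g xᶜ = W \ g x) ∧
    (∀ i x, g (c i x) = W ∩ Cyl i (g x)) ∧
    (∀ i j x, g (p i j x) = Transp i j (g x)) := by
  subst hW
  refine ⟨?_, ?_, ?_, ?_⟩
  · intro x y
    ext s
    simp only [hg, hfmeet, Set.mem_inter_iff, Set.mem_ofPred_eq]
    tauto
  · intro x
    ext s
    simp only [hg, hfcompl, Set.mem_sdiff, Set.mem_compl_iff, Set.mem_ofPred_eq]
    tauto
  · intro i x
    ext s
    simp only [hg, hfc, Cyl, Set.mem_inter_iff, Set.mem_ofPred_eq, hat_update]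
    constructor
    · rintro ⟨hs, u, hu⟩
      refine ⟨hs, ?_⟩
      obtain ⟨h, hh⟩ : ∃ h : H, ∀ k, (s k).2 ≠ h := by
        by_contra hcon
        push Not at hcon
        have := Cardinal.mk_le_of_surjective (f := fun k => (s k).2) hcon
        rw [Cardinal.mk_fin] at this
        exact absurd hH (not_lt.mpr this)
      exact ⟨(u, h), injective_update s hs i _ (fun k e => hh k (by rw [e])), hu⟩
    · rintro ⟨hs, v, _, hv⟩
      exact ⟨hs, v.1, hv⟩
  · intro i j x
    ext s
    simp only [hg, hfp, Transp, Set.mem_ofPred_eq, update_eq_swap]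
    exact and_congr_left' (Equiv.injective_comp (Equiv.swap i j) s).symm
end

section
/- (Theorem 2(ii)) Let 3 ≤ α < ω. The class RA^cp_α is not finitely axiomatizable over RA^p_α: there is no finite set Σ of equations in the cp similarity type such that for every algebra B of the cp similarity type, B satisfies Σ together with every p-type equation (using only ·, −, p_ij) valid in all full p set algebras if and only if B satisfies every cp-type equation valid in all full cp set algebras. -/
/-- Terms of the cp similarity type: Boolean `·`, `−` together with `c_i`, `p_ij`. -/
inductive CpTerm (n : ℕ) : Type
  | var : ℕ → CpTerm n
  | meet : CpTerm n → CpTerm n → CpTerm n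
  | compl : CpTerm n → CpTerm n
  | cyl : Fin n → CpTerm n → CpTerm n
  | perm : Fin n → Fin n → CpTerm n → CpTerm n

/-- Terms of the p similarity type: Boolean `·`, `−` together with `p_ij`. -/
inductive PTerm (n : ℕ) : Type
  | var : ℕ → PTerm n
  | meet : PTerm n → PTerm n → PTerm n
  | compl : PTerm n → PTerm n
  | perm : Fin n → Fin n → PTerm n → PTerm n

/-- An algebra of the cp similarity type. -/
structure CpAlg (n : ℕ) where
  carrier : Type
  meet : carrier → carrier → carrier
  compl : carrier → carrier
  cyl : Fin n → carrier → carrier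
  perm : Fin n → Fin n → carrier → carrier

/-- An algebra of the p similarity type. -/
structure PAlg (n : ℕ) where
  carrier : Type
  meet : carrier → carrier → carrier
  compl : carrier → carrier
  perm : Fin n → Fin n → carrier → carrier

/-- Evaluation of cp terms in a cp algebra under an assignment. -/
def CpAlg.eval {n : ℕ} (B : CpAlg n) (v : ℕ → B.carrier) : CpTerm n → B.carrier
  | .var m => v m
  | .meet t u => B.meet (B.eval v t) (B.eval v u)
  | .compl t => B.compl (B.eval v t)
  | .cyl i t => B.cyl i (B.eval v t)
  | .perm i j t => B.perm i j (B.eval v t)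

/-- Evaluation of p terms in a p algebra under an assignment. -/
def PAlg.eval {n : ℕ} (B : PAlg n) (v : ℕ → B.carrier) : PTerm n → B.carrier
  | .var m => v m
  | .meet t u => B.meet (B.eval v t) (B.eval v u)
  | .compl t => B.compl (B.eval v t)
  | .perm i j t => B.perm i j (B.eval v t)

/-- A cp algebra satisfies an equation if it holds under all assignments. -/
def CpAlg.Satisfies {n : ℕ} (B : CpAlg n) (e : CpTerm n × CpTerm n) : Prop :=
  ∀ v : ℕ → B.carrier, B.eval v e.1 = B.eval v e.2

/-- A p algebra satisfies an equation if it holds under all assignments. -/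
def PAlg.Satisfies {n : ℕ} (B : PAlg n) (e : PTerm n × PTerm n) : Prop :=
  ∀ v : ℕ → B.carrier, B.eval v e.1 = B.eval v e.2

/-- The full cp set algebra on a set `U`. -/
def fullCp (n : ℕ) (U : Type) : CpAlg n :=
  ⟨Set (Fin n → U), (· ∩ ·), fun X => Xᶜ, Cyl, Transp⟩

/-- The full p set algebra on a set `U`. -/
def fullP (n : ℕ) (U : Type) : PAlg n :=
  ⟨Set (Fin n → U), (· ∩ ·), fun X => Xᶜ, Transp⟩

/-- The p-type reduct of a cp algebra. -/
def CpAlg.pReduct {n : ℕ} (B : CpAlg n) : PAlg n :=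
  ⟨B.carrier, B.meet, B.compl, B.perm⟩

namespace CpProof

set_option linter.unusedVariables false

open Filter

/-! ### Networks and the non-representable algebras -/

/-- Colours: a main colour together with a shade. -/
abbrev Col := Finset ℕ × ℕ

/-- Pre-networks; `none` stands for the identity. -/
abbrev Net (n : ℕ) := Fin n → Fin n → Option Col

/-- Consistent networks of level `m`: no triangle is monochromatic. -/
structure Valid {n : ℕ} (m : ℕ) (N : Net n) : Prop where
  diag : ∀ i, N i i = none
  symm : ∀ i j, N i j = N j i
  congr : ∀ i j k, N i j = none → N i k = N j k
  bound : ∀ i j c, N i j = some c → c.1 ⊆ Finset.range (m + n)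
  mono : ∀ i j k a b c, N i j = some a → N i k = some b → N j k = some c →
    a.1 = b.1 → a.1 = c.1 → False

/-- Pulling a network back along a map of indices. -/
def pull {n : ℕ} (N : Net n) (f : Fin n → Fin n) : Net n := fun i j => N (f i) (f j)

lemma Valid.pull {n m : ℕ} {N : Net n} (h : Valid m N) (f : Fin n → Fin n) :
    Valid m (pull N f) where
  diag i := h.diag _
  symm i j := h.symm _ _
  congr i j k hh := h.congr _ _ _ hh
  bound i j c hh := h.bound _ _ _ hh
  mono i j k a b c h1 h2 h3 := h.mono _ _ _ a b c h1 h2 h3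

/-- The set of consistent networks. -/
abbrev XX (n m : ℕ) := {N : Net n // Valid m N}

/-- The complex algebra of the frame of consistent networks. -/
def BB (n m : ℕ) : CpAlg n :=
  ⟨Set (XX n m), (· ∩ ·), fun Y => Yᶜ,
    fun i Y => {x | ∃ y ∈ Y, ∀ j k, j ≠ i → k ≠ i → y.1 j k = x.1 j k},
    fun i j Y => {x | (⟨pull x.1 (Equiv.swap i j), x.2.pull _⟩ : XX n m) ∈ Y}⟩

lemma upd_swap {n : ℕ} {U : Type} (s : Fin n → U) (i j : Fin n) :
    Function.update (Function.update s i (s j)) j (s i) = fun k => s (Equiv.swap i j k) := by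
  funext k
  simp only [Function.update_apply, Equiv.swap_apply_def]
  split_ifs <;> simp_all

/-- Evaluation in the p-reduct of `BB`, as a set. -/
def pbev {n m : ℕ} (v : ℕ → Set (XX n m)) (t : PTerm n) : Set (XX n m) :=
  (BB n m).pReduct.eval v t

/-- Evaluation in the full p set algebra, as a set. -/
def pfev {n : ℕ} {U : Type} (v : ℕ → Set (Fin n → U)) (t : PTerm n) : Set (Fin n → U) :=
  (fullP n U).eval v t

/-- Evaluation in `BB`, as a set. -/
def bev {n m : ℕ} (v : ℕ → Set (XX n m)) (t : CpTerm n) : Set (XX n m) :=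
  (BB n m).eval v t

/-- Evaluation in the full cp set algebra, as a set. -/
def fev {n : ℕ} {U : Type} (v : ℕ → Set (Fin n → U)) (t : CpTerm n) : Set (Fin n → U) :=
  (fullCp n U).eval v t

/-- The p-reduct of `BB` satisfies all valid p-equations. -/
lemma BB_p (n m : ℕ) (e : PTerm n × PTerm n)
    (he : ∀ U : Type, (fullP n U).Satisfies e) : (BB n m).pReduct.Satisfies e := by
  intro v
  have key : ∀ (v : ℕ → Set (XX n m)) (x : XX n m) (t : PTerm n) (s : Fin n → Fin n),
      s ∈ pfev (fun l => {s | (⟨pull x.1 s, x.2.pull _⟩ : XX n m) ∈ v l}) t ↔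
      (⟨pull x.1 s, x.2.pull _⟩ : XX n m) ∈ pbev v t := by
    intro v x t
    induction t with
    | var l => intro s; exact Iff.rfl
    | meet t u iht ihu => intro s; exact and_congr (iht s) (ihu s)
    | compl t ih => intro s; exact not_congr (ih s)
    | perm i j t ih =>
      intro s
      have h := ih (Function.update (Function.update s i (s j)) j (s i))
      refine Iff.trans h ?_
      simp only [upd_swap]
      exact Iff.rfl
  revert v
  intro (v : ℕ → Set (XX n m))
  apply Set.ext
  intro x
  have h1 := key v x e.1 id
  have h2 := key v x e.2 id
  have h3 : pfev _ e.1 = pfev _ e.2 := he (Fin n) (fun l => ({s | (⟨pull x.1 s, x.2.pull _⟩ : XX n m) ∈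
    v l} : Set (Fin n → Fin n)))
  rw [h3] at h1
  exact h1.symm.trans h2

/-! ### A Ramsey lemma -/

lemma ramsey {κ : Type} [DecidableEq κ] (K : Finset κ) : ∃ N : ℕ, ∀ (A : Finset ℕ)
    (f : ℕ → ℕ → κ), N ≤ A.card → (∀ x ∈ A, ∀ y ∈ A, x ≠ y → f x y ∈ K) →
    ∃ x ∈ A, ∃ y ∈ A, ∃ z ∈ A, x ≠ y ∧ x ≠ z ∧ y ≠ z ∧ f x y = f x z ∧ f x y = f y z := by
  induction hK : K.card generalizing K with
  | zero =>
    refine ⟨2, fun A f hA h => ?_⟩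
    obtain ⟨x, hx, y, hy, hxy⟩ := Finset.one_lt_card.1 (by omega : 1 < A.card)
    have := h x hx y hy hxy
    rw [Finset.card_eq_zero.1 hK] at this
    simp at this
  | succ r ih =>
    have : ∀ c ∈ K, ∃ N : ℕ, ∀ (A : Finset ℕ)
      (f : ℕ → ℕ → κ), N ≤ A.card → (∀ x ∈ A, ∀ y ∈ A, x ≠ y → f x y ∈ K.erase c) →
      ∃ x ∈ A, ∃ y ∈ A, ∃ z ∈ A, x ≠ y ∧ x ≠ z ∧ y ≠ z ∧ f x y = f x z ∧ f x y = f y z := by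
      intro c hc
      exact ih _ (by rw [Finset.card_erase_of_mem hc]; omega)
    choose! M hM using this
    refine ⟨(∑ c ∈ K, M c) + K.card + 2, fun A f hA h => ?_⟩
    obtain ⟨x, hx⟩ : A.Nonempty := Finset.card_pos.1 (by omega)
    have hlt : ∑ c ∈ K, M c < (A.erase x).card := by
      rw [Finset.card_erase_of_mem hx]; omega
    have hmaps : ∀ y ∈ A.erase x, f x y ∈ K := fun y hy =>
      h x hx y (Finset.mem_of_mem_erase hy) (Finset.ne_of_mem_erase hy).symm
    rw [Finset.card_eq_sum_card_fiberwise hmaps] at hlt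
    obtain ⟨c, hc, hlt⟩ := Finset.exists_lt_of_sum_lt hlt
    by_cases hmono : ∃ y ∈ A.erase x, ∃ z ∈ A.erase x, y ≠ z ∧ f x y = c ∧ f x z = c ∧ f y z = c
    · obtain ⟨y, hy, z, hz, hyz, h1, h2, h3⟩ := hmono
      exact ⟨x, hx, y, Finset.mem_of_mem_erase hy, z, Finset.mem_of_mem_erase hz,
        (Finset.ne_of_mem_erase hy).symm, (Finset.ne_of_mem_erase hz).symm, hyz,
        h1.trans h2.symm, h1.trans h3.symm⟩
    · push Not at hmono
      obtain ⟨y, hy, z, hz, w, hw, hh⟩ := hM c hc _ f hlt.le (by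
        intro y hy z hz hyz
        rw [Finset.mem_filter] at hy hz
        rw [Finset.mem_erase]
        exact ⟨hmono y hy.1 z hz.1 hyz hy.2 hz.2, h y (Finset.mem_of_mem_erase hy.1) z
          (Finset.mem_of_mem_erase hz.1) hyz⟩)
      rw [Finset.mem_filter] at hy hz hw
      exact ⟨y, Finset.mem_of_mem_erase hy.1, z, Finset.mem_of_mem_erase hz.1,
        w, Finset.mem_of_mem_erase hw.1, hh⟩

/-! ### Non-representability -/

/-- Join of two terms. -/
def tor {n : ℕ} (t u : CpTerm n) : CpTerm n := .compl (.meet (.compl t) (.compl u))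

/-- The zero term. -/
def tzero (n : ℕ) : CpTerm n := .meet (.var 0) (.compl (.var 0))

/-- Join of a list of terms. -/
def tOr {n : ℕ} : List (CpTerm n) → CpTerm n
  | [] => tzero n
  | t :: l => tor t (tOr l)

/-- Iterated cylindrification. -/
def tCyl {n : ℕ} (t : CpTerm n) : List (Fin n) → CpTerm n
  | [] => t
  | i :: l => .cyl i (tCyl t l)

lemma mem_fev_tOr {n : ℕ} {U : Type} (v : ℕ → Set (Fin n → U)) (l : List (CpTerm n))
    (s : Fin n → U) : s ∈ fev v (tOr l) ↔ ∃ t ∈ l, s ∈ fev v t := by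
  induction l with
  | nil =>
    have : s ∈ fev v (tOr []) ↔ (s ∈ v 0 ∧ ¬ s ∈ v 0) := Iff.rfl
    rw [this]; simp
  | cons t l ih =>
    have : s ∈ fev v (tOr (t :: l)) ↔ ¬ (¬ s ∈ fev v t ∧ ¬ s ∈ fev v (tOr l)) := Iff.rfl
    rw [this, ih]; simp; tauto

lemma mem_bev_tOr {n m : ℕ} (v : ℕ → Set (XX n m)) (l : List (CpTerm n))
    (s : XX n m) : s ∈ bev v (tOr l) ↔ ∃ t ∈ l, s ∈ bev v t := by
  induction l with
  | nil =>
    have : s ∈ bev v (tOr []) ↔ (s ∈ v 0 ∧ ¬ s ∈ v 0) := Iff.rfl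
    rw [this]; simp
  | cons t l ih =>
    have : s ∈ bev v (tOr (t :: l)) ↔ ¬ (¬ s ∈ bev v t ∧ ¬ s ∈ bev v (tOr l)) := Iff.rfl
    rw [this, ih]; simp; tauto

lemma mem_fev_tCyl {n : ℕ} {U : Type} (v : ℕ → Set (Fin n → U)) (t : CpTerm n)
    (r : Fin n → U) (hr : r ∈ fev v t) (l : List (Fin n)) :
    ∀ s : Fin n → U, (∀ i, i ∉ l → s i = r i) → s ∈ fev v (tCyl t l) := by
  induction l with
  | nil =>
    intro s hs
    have : s = r := funext fun i => hs i (by simp)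
    rw [this]; exact hr
  | cons i l ih =>
    intro s hs
    refine ⟨r i, ih _ ?_⟩
    intro j hj
    by_cases hji : j = i
    · subst hji; simp
    · rw [Function.update_of_ne hji]; exact hs j (by simp [hji, hj])

lemma bev_tCyl {n m : ℕ} (v : ℕ → Set (XX n m)) (t : CpTerm n)
    (ht : ∀ x, x ∉ bev v t) (l : List (Fin n)) : ∀ x, x ∉ bev v (tCyl t l) := by
  induction l with
  | nil => exact ht
  | cons i l ih =>
    rintro x ⟨y, hy, -⟩
    exact ih y hy

/-- Variable for a main colour. -/
def va {n : ℕ} (k : Finset ℕ) : CpTerm n := .var (Encodable.encode (Sum.inl k : Finset ℕ ⊕ ℕ))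

/-- Variable for a shade. -/
def vb {n : ℕ} (s : ℕ) : CpTerm n := .var (Encodable.encode (Sum.inr s : Finset ℕ ⊕ ℕ))

section
variable {n : ℕ} (i0 i1 i2 : Fin n) (K : List (Finset ℕ)) (M : ℕ)

/-- The violations; they are all empty in `BB`, but not in a full set algebra. -/
def viol : List (CpTerm n) :=
  (K.map fun k => .meet (.cyl i2 (va k)) (.compl (va k))) ++
  ((List.range M).map fun s => .meet (.cyl i2 (vb s)) (.compl (vb s))) ++
  ((List.range M).map fun s => .compl (.cyl i1 (vb s))) ++
  (((List.range M ×ˢ List.range M).filter fun p => p.1 ≠ p.2).map fun p =>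
    .meet (.meet (vb p.1) (.perm i1 i2 (vb p.2)))
      (.compl (.perm i0 i1 (.perm i1 i2 (tOr (K.map va)))))) ++
  (K.map fun k => .meet (.meet (va k) (.perm i1 i2 (va k))) (.perm i0 i1 (.perm i1 i2 (va k))))

end

/-- The canonical assignment in `BB`. -/
def cv {n : ℕ} (m : ℕ) (i0 i1 : Fin n) (l : ℕ) : Set (XX n m) :=
  match (Encodable.decode l : Option (Finset ℕ ⊕ ℕ)) with
  | some (Sum.inl k) => {x | ∃ s, x.1 i0 i1 = some (k, s)}
  | some (Sum.inr s) => {x | ∃ k, x.1 i0 i1 = some (k, s)}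
  | none => ∅

lemma bev_va {n m : ℕ} (i0 i1 : Fin n) (k : Finset ℕ) :
    bev (cv m i0 i1) (va k) = {x : XX n m | ∃ s, x.1 i0 i1 = some (k, s)} := by
  change cv m i0 i1 _ = _
  simp only [cv, Encodable.encodek]

lemma bev_vb {n m : ℕ} (i0 i1 : Fin n) (s : ℕ) :
    bev (cv m i0 i1) (vb s) = {x : XX n m | ∃ k, x.1 i0 i1 = some (k, s)} := by
  change cv m i0 i1 _ = _
  simp only [cv, Encodable.encodek]

/-- Extending by a point with given shade. -/
lemma exists_shade {n m : ℕ} (x : XX n m) (i1 : Fin n) (s : ℕ) :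
    ∃ y : XX n m, (∀ j k, j ≠ i1 → k ≠ i1 → y.1 j k = x.1 j k) ∧
      ∀ j, j ≠ i1 → ∃ k, y.1 j i1 = some (k, s) := by
  classical
  obtain ⟨N, hN⟩ := x
  let cl : Fin n → Finset ℕ := fun j =>
    (Finset.univ.filter fun j' : Fin n => N j j' = none).image Fin.val
  have hcl : ∀ j k, N j k = none → cl j = cl k := by
    intro j k h
    simp only [cl]
    congr 1
    ext j'
    simp [hN.congr j k j' h]
  have hcl' : ∀ j k, cl j = cl k → N j k = none := by
    intro j k h
    have : (k : ℕ) ∈ cl k := by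
      simp only [cl, Finset.mem_image, Finset.mem_filter, Finset.mem_univ, true_and]
      exact ⟨k, hN.diag k, rfl⟩
    rw [← h] at this
    simp only [cl, Finset.mem_image, Finset.mem_filter, Finset.mem_univ, true_and] at this
    obtain ⟨a, ha, hak⟩ := this
    rwa [Fin.ext hak] at ha
  have hclb : ∀ j, cl j ⊆ Finset.range (m + n) := by
    intro j a ha
    simp only [cl, Finset.mem_image, Finset.mem_filter, Finset.mem_univ, true_and] at ha
    obtain ⟨a, ha, rfl⟩ := ha
    rw [Finset.mem_range]; have := a.2; omega
  let y : Net n := fun j k =>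
    if j = i1 then (if k = i1 then none else some (cl k, s))
    else if k = i1 then some (cl j, s) else N j k
  refine ⟨⟨y, ?_, ?_, ?_, ?_, ?_⟩, ?_, ?_⟩
  · intro i; simp only [y]; split_ifs; rfl; exact hN.diag i
  · intro i j; simp only [y]; split_ifs <;> first | rfl | exact hN.symm i j
  · intro i j k h
    simp only [y] at h ⊢
    split_ifs at h ⊢ <;> first | rfl | (simp_all; done) | skip
    · rw [hcl i j h]
    · exact hN.congr i j k h
  · intro i j c h
    simp only [y] at h
    split_ifs at h
    · cases h; exact hclb _
    · cases h; exact hclb _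
    · exact hN.bound i j c h
  · intro i j k a b c h1 h2 h3 hab hac
    simp only [y] at h1 h2 h3
    split_ifs at h1 h2 h3
    · cases h1; cases h2
      rw [hcl' _ _ hab] at h3; cases h3
    · cases h1; cases h3
      rw [hcl' _ _ hac] at h2; cases h2
    · cases h2; cases h3
      rw [hcl' _ _ (hab.symm.trans hac)] at h1; cases h1
    · exact hN.mono i j k a b c h1 h2 h3 hab hac
  · intro j k hj hk
    simp [y, hj, hk]
  · intro j hj
    exact ⟨cl j, by simp [y, hj]⟩

lemma viol_BB {n m : ℕ} (i0 i1 i2 : Fin n) (h01 : i0 ≠ i1) (h02 : i0 ≠ i2) (h12 : i1 ≠ i2)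
    (M : ℕ) (t : CpTerm n)
    (ht : t ∈ viol i0 i1 i2 (Finset.range (m + n)).powerset.toList M) (x : XX n m) :
    x ∉ bev (cv m i0 i1) t := by
  intro hx
  have e0 : Equiv.swap i1 i2 i0 = i0 := Equiv.swap_apply_of_ne_of_ne h01 h02
  have e2 : Equiv.swap i0 i1 i2 = i2 := Equiv.swap_apply_of_ne_of_ne h02.symm h12.symm
  simp only [viol, List.mem_append, List.mem_map, List.mem_filter] at ht
  rcases ht with (((ht | ht) | ht) | ht) | ht
  · obtain ⟨k, -, rfl⟩ := ht
    obtain ⟨⟨y, hy, hxy⟩, hx⟩ := hx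
    apply hx
    change y ∈ bev (cv m i0 i1) (va k) at hy
    change x ∈ bev (cv m i0 i1) (va k)
    rw [bev_va] at hy ⊢
    obtain ⟨s, hs⟩ := hy
    exact ⟨s, by rw [← hs, hxy i0 i1 h02 h12]⟩
  · obtain ⟨k, -, rfl⟩ := ht
    obtain ⟨⟨y, hy, hxy⟩, hx⟩ := hx
    apply hx
    change y ∈ bev (cv m i0 i1) (vb k) at hy
    change x ∈ bev (cv m i0 i1) (vb k)
    rw [bev_vb] at hy ⊢
    obtain ⟨s, hs⟩ := hy
    exact ⟨s, by rw [← hs, hxy i0 i1 h02 h12]⟩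
  · obtain ⟨s, -, rfl⟩ := ht
    apply hx
    obtain ⟨y, hxy, hy⟩ := exists_shade x i1 s
    refine ⟨y, ?_, hxy⟩
    change y ∈ bev (cv m i0 i1) (vb s)
    rw [bev_vb]
    exact hy i0 h01
  · obtain ⟨⟨s, t⟩, ⟨-, hst⟩, rfl⟩ := ht
    obtain ⟨⟨h1, h2⟩, h3⟩ := hx
    change x ∈ bev (cv m i0 i1) (vb s) at h1
    change _ ∈ bev (cv m i0 i1) (vb t) at h2
    rw [bev_vb] at h1 h2
    obtain ⟨a, h1⟩ := h1
    obtain ⟨b, h2⟩ := h2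
    simp only [pull, e0, Equiv.swap_apply_left] at h2
    apply h3
    change _ ∈ bev (cv m i0 i1) (tOr _)
    rw [mem_bev_tOr]
    simp only [List.mem_map]
    have hne : x.1 i1 i2 ≠ none := by
      intro h
      have := x.2.congr _ _ i0 h
      rw [x.2.symm i1, x.2.symm i2, h1, h2] at this
      simp only [Option.some.injEq, Prod.mk.injEq] at this
      simp [this.2] at hst
    obtain ⟨⟨k, r⟩, hk⟩ := Option.ne_none_iff_exists'.1 hne
    refine ⟨va k, ⟨k, ?_, rfl⟩, ?_⟩
    · simp only [Finset.mem_toList, Finset.mem_powerset]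
      exact x.2.bound _ _ _ hk
    · rw [bev_va]
      refine ⟨r, ?_⟩
      simp only [pull, e0, e2, Equiv.swap_apply_left]
      exact hk
  · obtain ⟨k, -, rfl⟩ := ht
    obtain ⟨⟨h1, h2⟩, h3⟩ := hx
    change _ ∈ bev (cv m i0 i1) (va k) at h1
    change _ ∈ bev (cv m i0 i1) (va k) at h2
    change _ ∈ bev (cv m i0 i1) (va k) at h3
    rw [bev_va] at h1 h2 h3
    obtain ⟨a, h1⟩ := h1
    obtain ⟨b, h2⟩ := h2
    obtain ⟨c, h3⟩ := h3
    simp only [pull, e0, e2, Equiv.swap_apply_left] at h2 h3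
    exact x.2.mono _ _ _ _ _ _ h1 h2 h3 rfl rfl

/-- A triple, filled up with a constant. -/
def tup {n : ℕ} {U : Type} (i0 i1 i2 : Fin n) (z a b c : U) : Fin n → U := fun i =>
  if i = i0 then a else if i = i1 then b else if i = i2 then c else z

section
variable {n : ℕ} {U : Type} {i0 i1 i2 : Fin n} (z : U)

lemma tup_up1 (h01 : i0 ≠ i1) (a b c b' : U) :
    Function.update (tup i0 i1 i2 z a b c) i1 b' = tup i0 i1 i2 z a b' c := by
  funext i
  simp only [tup, Function.update_apply]
  split_ifs <;> simp_all

lemma tup_up2 (h02 : i0 ≠ i2) (h12 : i1 ≠ i2) (a b c c' : U) :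
    Function.update (tup i0 i1 i2 z a b c) i2 c' = tup i0 i1 i2 z a b c' := by
  funext i
  simp only [tup, Function.update_apply]
  split_ifs <;> simp_all

lemma tup_up0 (a b c a' : U) :
    Function.update (tup i0 i1 i2 z a b c) i0 a' = tup i0 i1 i2 z a' b c := by
  funext i
  simp only [tup, Function.update_apply]
  split_ifs <;> simp_all

end

lemma viol_full {n : ℕ} (i0 i1 i2 : Fin n) (h01 : i0 ≠ i1) (h02 : i0 ≠ i2)
    (h12 : i1 ≠ i2) (K : Finset (Finset ℕ)) : ∃ M : ℕ, ∀ (U : Type) (z : U)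
    (v : ℕ → Set (Fin n → U)), ∃ t ∈ viol i0 i1 i2 K.toList M, ∃ s, s ∈ fev v t := by
  obtain ⟨M, hM⟩ := ramsey K
  refine ⟨M, fun U z v => ?_⟩
  by_contra hcon
  push Not at hcon
  simp only [viol, List.mem_append, List.mem_map, List.mem_filter, List.mem_range,
    Finset.mem_toList] at hcon
  let T := tup i0 i1 i2 z
  have up1 : ∀ a b c b', Function.update (T a b c) i1 b' = T a b' c := by
    exact tup_up1 z h01
  have up2 : ∀ a b c c', Function.update (T a b c) i2 c' = T a b c' := by
    exact tup_up2 z h02 h12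
  have t12 : ∀ a b c t, T a b c ∈ fev v (.perm i1 i2 t) ↔ T a c b ∈ fev v t := by
    intro a b c t
    have : Function.update (Function.update (T a b c) i1 (T a b c i2)) i2 (T a b c i1) =
        T a c b := by
      have e1 : T a b c i1 = b := by simp [T, tup, h01.symm]
      have e2 : T a b c i2 = c := by simp [T, tup, h02.symm, h12.symm]
      rw [e1, e2, up1, up2]
    rw [← this]; exact Iff.rfl
  have t01 : ∀ a b c t, T a b c ∈ fev v (.perm i0 i1 t) ↔ T b a c ∈ fev v t := by
    intro a b c t
    have : Function.update (Function.update (T a b c) i0 (T a b c i1)) i1 (T a b c i0) =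
        T b a c := by
      have e1 : T a b c i1 = b := by simp [T, tup, h01.symm]
      have e2 : T a b c i0 = a := by simp [T, tup]
      rw [e1, e2]
      simp only [T]
      rw [tup_up0, tup_up1 z h01]
    rw [← this]; exact Iff.rfl
  have F1a : ∀ k ∈ K, ∀ a b c c', T a b c ∈ fev v (va k) → T a b c' ∈ fev v (va k) := by
    intro k hk a b c c' h
    by_contra hn
    refine hcon _ (Or.inl (Or.inl (Or.inl (Or.inl ⟨k, hk, rfl⟩)))) (T a b c') ⟨⟨c, ?_⟩, hn⟩
    rw [up2]; exact h
  have F1b : ∀ k < M, ∀ a b c c', T a b c ∈ fev v (vb k) → T a b c' ∈ fev v (vb k) := by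
    intro k hk a b c c' h
    by_contra hn
    refine hcon _ (Or.inl (Or.inl (Or.inl (Or.inr ⟨k, hk, rfl⟩)))) (T a b c') ⟨⟨c, ?_⟩, hn⟩
    rw [up2]; exact h
  have F2 : ∀ k < M, ∃ b, T z b z ∈ fev v (vb k) := by
    intro k hk
    by_contra hn
    refine hcon _ (Or.inl (Or.inl (Or.inr ⟨k, hk, rfl⟩))) (T z z z) ?_
    rintro ⟨b, hb⟩
    rw [up1] at hb
    exact hn ⟨b, hb⟩
  have : Nonempty U := ⟨z⟩
  choose! p hp using F2
  have F3 : ∀ s < M, ∀ t < M, s ≠ t → ∃ k ∈ K, T (p s) (p t) z ∈ fev v (va k) := by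
    intro s hs t ht hst
    by_contra hn
    push Not at hn
    refine hcon _ (Or.inl (Or.inr ⟨(s, t), ⟨?_, by simpa using hst⟩, rfl⟩))
      (T z (p s) (p t)) ⟨⟨?_, ?_⟩, ?_⟩
    · exact List.pair_mem_product.2 ⟨List.mem_range.2 hs, List.mem_range.2 ht⟩
    · exact F1b s hs _ _ _ _ (hp s hs)
    · exact (t12 _ _ _ _).2 (F1b t ht _ _ _ _ (hp t ht))
    · intro h
      have h := (t12 _ _ _ _).1 ((t01 _ _ _ _).1 h)
      rw [mem_fev_tOr] at h
      obtain ⟨_, ha, h⟩ := h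
      rw [List.mem_map] at ha
      obtain ⟨k, hk, rfl⟩ := ha
      rw [Finset.mem_toList] at hk
      exact hn k hk (F1a k hk _ _ _ _ h)
  choose! f hfK hf using F3
  obtain ⟨x, hx, y, hy, w, hw, hxy, hxw, hyw, e1, e2⟩ := hM (Finset.range M) f (by simp) (by
    intro x hx y hy hxy
    exact hfK x (Finset.mem_range.1 hx) y (Finset.mem_range.1 hy) hxy)
  rw [Finset.mem_range] at hx hy hw
  have hk := hfK x hx y hy hxy
  have q1 := hf x hx y hy hxy
  have q2 := hf x hx w hw hxw
  have q3 := hf y hy w hw hyw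
  rw [← e1] at q2
  rw [← e2] at q3
  refine hcon _ (Or.inr ⟨f x y, hk, rfl⟩) (T (p x) (p y) (p w)) ⟨⟨?_, ?_⟩, ?_⟩
  · exact F1a _ hk _ _ _ _ q1
  · exact (t12 _ _ _ _).2 (F1a _ hk _ _ _ _ q2)
  · exact (t01 _ _ _ _).2 ((t12 _ _ _ _).2 (F1a _ hk _ _ _ _ q3))

lemma valid_none {n m : ℕ} : Valid m (fun _ _ => none : Net n) := by
  constructor <;> simp

/-- `BB` fails some valid cp-equation. -/
lemma BB_not_rep (n m : ℕ) (hn : 3 ≤ n) : ∃ e : CpTerm n × CpTerm n,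
    (∀ U : Type, (fullCp n U).Satisfies e) ∧ ¬ (BB n m).Satisfies e := by
  let i0 : Fin n := ⟨0, by omega⟩
  let i1 : Fin n := ⟨1, by omega⟩
  let i2 : Fin n := ⟨2, by omega⟩
  have h01 : i0 ≠ i1 := by simp [i0, i1]
  have h02 : i0 ≠ i2 := by simp [i0, i2]
  have h12 : i1 ≠ i2 := by simp [i1, i2]
  obtain ⟨M, hM⟩ := viol_full i0 i1 i2 h01 h02 h12 (Finset.range (m + n)).powerset
  refine ⟨(tCyl (tOr (viol i0 i1 i2 (Finset.range (m + n)).powerset.toList M))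
    (List.finRange n), .compl (tzero n)), ?_, ?_⟩
  · intro U
    change ∀ v : ℕ → Set (Fin n → U), fev v _ = fev v _
    intro v
    ext s
    obtain ⟨t, ht, r, hr⟩ := hM U (s i0) v
    refine iff_of_true ?_ ?_
    · exact mem_fev_tCyl v _ r ((mem_fev_tOr _ _ _).2 ⟨t, ht, hr⟩) _ _
        (fun i hi => (hi (List.mem_finRange i)).elim)
    · change ¬ (s ∈ v 0 ∧ ¬ s ∈ v 0)
      simp
  · intro h
    have h : bev (cv m i0 i1) _ = bev (cv m i0 i1) _ := h (cv m i0 i1)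
    let x : XX n m := ⟨_, valid_none⟩
    refine bev_tCyl (cv m i0 i1) _ ?_ (List.finRange n) x (h.superset ?_)
    · intro y hy
      obtain ⟨t, ht, hy⟩ := (mem_bev_tOr _ _ _).1 hy
      exact viol_BB i0 i1 i2 h01 h02 h12 M t ht y hy
    · change ¬ (x ∈ cv m i0 i1 0 ∧ ¬ x ∈ cv m i0 i1 0)
      simp

/-! ### Points of the limit representation -/

/-- The ultrafilter used to pass to the limit. -/
noncomputable def UU : Filter ℕ := (hyperfilter ℕ : Filter ℕ)

lemma UU_not {p : ℕ → Prop} : (∀ᶠ m in UU, ¬ p m) ↔ ¬ ∀ᶠ m in UU, p m :=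
  Ultrafilter.eventually_not

instance : UU.NeBot := inferInstanceAs ((hyperfilter ℕ : Filter ℕ).NeBot)

lemma UU_ge (k : ℕ) : ∀ᶠ m in UU, k ≤ m :=
  (eventually_ge_atTop k).filter_mono Nat.hyperfilter_le_atTop

/-- Points of the limit representation: well-founded witness trees. -/
inductive Pt (n : ℕ) : Type
  | leaf : Pt n
  | node : Fin n → (Fin n → Pt n) → (Fin n → ℕ → Col) → Pt n

/-- Depth of a point. -/
def depth {n : ℕ} : Pt n → ℕ
  | .leaf => 0
  | .node _ W _ => 1 + Finset.univ.sup (fun j => depth (W j))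

/-- `w` is a child of `z`. -/
def Child {n : ℕ} (w : Pt n) : Pt n → Prop
  | .leaf => False
  | .node i W _ => ∃ j, j ≠ i ∧ W j = w

lemma Child.depth_lt {n : ℕ} {w z : Pt n} (h : Child w z) : depth w < depth z := by
  cases z with
  | leaf => exact h.elim
  | node i W g =>
    obtain ⟨j, hj, rfl⟩ := h
    have := Finset.le_sup (f := fun j => depth (W j)) (Finset.mem_univ j)
    simp only [depth]
    omega

lemma Child.ne {n : ℕ} {w z : Pt n} (h : Child w z) : w ≠ z := by
  rintro rfl; exact lt_irrefl _ h.depth_lt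

lemma Child.asymm {n : ℕ} {w z : Pt n} (h : Child w z) : ¬ Child z w :=
  fun h' => lt_asymm h.depth_lt h'.depth_lt

open Classical in
/-- The prescribed colour between a point and its child. -/
noncomputable def hval {n : ℕ} (z w : Pt n) : ℕ → Col :=
  match z with
  | .leaf => fun _ => default
  | .node i W h => if ex : ∃ j, j ≠ i ∧ W j = w then h ex.choose else fun _ => default

lemma child_finite {n : ℕ} (z : Pt n) : {w | Child w z}.Finite := by
  cases z with
  | leaf => simp [Child]
  | node i W g =>
    refine (Set.finite_range W).subset ?_
    rintro w ⟨j, _, rfl⟩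
    exact ⟨j, rfl⟩

/-! ### Cardinality -/

/-- Shapes of nodes. -/
abbrev Shape (n : ℕ) := Option (Fin n × (Fin n → ℕ → Col))

/-- Arities of shapes. -/
def Ar (n : ℕ) : Shape n → Type
  | none => Empty
  | some _ => Fin n

instance (n : ℕ) : ∀ a, Finite (Ar n a)
  | none => inferInstanceAs (Finite Empty)
  | some _ => inferInstanceAs (Finite (Fin n))

/-- Points as elements of a W-type. -/
def toW {n : ℕ} : Pt n → WType (Ar n)
  | .leaf => ⟨none, fun x => x.elim⟩
  | .node i W h => ⟨some (i, h), fun j => toW (W j)⟩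

lemma toW_inj {n : ℕ} : Function.Injective (toW (n := n)) := by
  intro x
  induction x with
  | leaf => intro y hy; cases y with
    | leaf => rfl
    | node i W h => simp [toW] at hy
  | node i W h ih => intro y hy; cases y with
    | leaf => simp [toW] at hy
    | node i' W' h' =>
      simp only [toW, WType.mk.injEq, Option.some.injEq, Prod.mk.injEq] at hy
      obtain ⟨⟨rfl, rfl⟩, h2⟩ := hy
      have h2 := eq_of_heq h2
      have : W = W' := by
        funext j
        exact ih j (congrFun h2 j)
      rw [this]

open Cardinal in
lemma mk_pt (n : ℕ) : #(Pt n) ≤ 𝔠 := by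
  refine (mk_le_of_injective toW_inj).trans (WType.cardinalMk_le_max_aleph0_of_finite.trans ?_)
  refine max_le ?_ aleph0_le_continuum
  have h1 : #(Shape n) ≤ #(Option ((ℕ → ℕ) × ((Fin n × ℕ) → ℕ))) := by
    obtain ⟨f, hf⟩ := exists_injective_nat (Fin n)
    obtain ⟨g, hg⟩ := exists_injective_nat Col
    refine mk_le_of_injective (f := Option.map (fun p : Fin n × (Fin n → ℕ → Col) =>
      ((fun _ => f p.1 : ℕ → ℕ), fun q : Fin n × ℕ => g (p.2 q.1 q.2)))) ?_
    refine Option.map_injective ?_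
    rintro ⟨a, b⟩ ⟨c, d⟩ h
    simp only [Prod.mk.injEq] at h
    refine Prod.ext (hf (congrFun h.1 0)) ?_
    funext j l
    exact hg (congrFun h.2 (j, l))
  refine h1.trans ?_
  rw [mk_option, mk_prod]
  have a1 : #(ℕ → ℕ) ≤ 𝔠 := by simp
  have a2 : #(Fin n × ℕ → ℕ) ≤ 𝔠 := by
    have : #(Fin n × ℕ) ≤ ℵ₀ := mk_le_aleph0
    simp only [← power_def, mk_nat]
    calc ℵ₀ ^ #(Fin n × ℕ) ≤ ℵ₀ ^ ℵ₀ := power_le_power_left aleph0_ne_zero this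
      _ = 𝔠 := by simp
  simp only [lift_id]
  calc #(ℕ → ℕ) * #(Fin n × ℕ → ℕ) + 1 ≤ 𝔠 * 𝔠 + 1 := by gcongr
    _ = 𝔠 := by rw [continuum_mul_self, ← Nat.cast_one, continuum_add_nat]

open Cardinal in
lemma exists_code (n : ℕ) : ∃ f : Sym2 (Pt n) × ℕ → Set ℕ, Function.Injective f := by
  have : #(Sym2 (Pt n) × ℕ) ≤ #(Set ℕ) := by
    have h1 : #(Sym2 (Pt n)) ≤ #(Pt n × Pt n) :=
      mk_le_of_surjective (f := Quot.mk _) Quot.mk_surjective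
    rw [mk_prod] at h1 ⊢
    simp only [lift_id, mk_nat, mk_set] at *
    calc #(Sym2 (Pt n)) * ℵ₀ ≤ (𝔠 * 𝔠) * 𝔠 := by
          gcongr
          · exact h1.trans (by gcongr <;> exact mk_pt n)
          · exact aleph0_le_continuum
      _ = 2 ^ ℵ₀ := by simp
  obtain ⟨f⟩ := this
  exact ⟨f, f.injective⟩

/-- Codes. -/
noncomputable def code (n : ℕ) : Sym2 (Pt n) × ℕ → Set ℕ := (exists_code n).choose

lemma code_inj (n : ℕ) : Function.Injective (code n) := (exists_code n).choose_spec

open Classical in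
/-- Finite approximations of a set. -/
noncomputable def FF (A : Set ℕ) (m : ℕ) : Finset ℕ := (Finset.range m).filter (· ∈ A)

lemma FF_lt {A : Set ℕ} {m k : ℕ} (h : k ∈ FF A m) : k < m := by
  simp only [FF, Finset.mem_filter, Finset.mem_range] at h
  exact h.1

lemma FF_ne {A B : Set ℕ} (h : A ≠ B) : ∀ᶠ m in UU, FF A m ≠ FF B m := by
  have : ∃ k, ¬ (k ∈ A ↔ k ∈ B) := by
    by_contra hh
    push Not at hh
    exact h (Set.ext hh)
  obtain ⟨k, hk⟩ := this
  filter_upwards [UU_ge (k + 1)] with m hm heq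
  apply hk
  have := Finset.ext_iff.1 heq k
  simp only [FF, Finset.mem_filter, Finset.mem_range] at this
  constructor
  · intro h; exact (this.1 ⟨by omega, h⟩).2
  · intro h; exact (this.2 ⟨by omega, h⟩).2

lemma exists_q {n : ℕ} (e : Sym2 (Pt n)) : ∃ q : ℕ, ∀ z ∈ e, ∀ w, Child w z →
    ∀ᶠ m in UU, (hval z w m).1 ≠ FF (code n (e, q)) m := by
  by_contra hcon
  push Not at hcon
  have hfin : {p : Pt n × Pt n | p.1 ∈ e ∧ Child p.2 p.1}.Finite := by
    induction e using Sym2.ind with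
    | _ a b =>
      refine (((Set.finite_singleton a).prod (child_finite a)).union
        ((Set.finite_singleton b).prod (child_finite b))).subset ?_
      rintro ⟨z, w⟩ ⟨hz, hw⟩
      rcases Sym2.mem_iff.1 hz with rfl | rfl
      · exact Or.inl ⟨rfl, hw⟩
      · exact Or.inr ⟨rfl, hw⟩
  choose z hz w hw hzw using hcon
  have := hfin.to_subtype
  obtain ⟨q, q', hne, heq⟩ := Finite.exists_ne_map_eq_of_infinite
    (fun q => (⟨(z q, w q), hz q, hw q⟩ : {p : Pt n × Pt n | p.1 ∈ e ∧ Child p.2 p.1}))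
  simp only [Subtype.mk.injEq, Prod.mk.injEq] at heq
  have h1 : ∀ q, ∀ᶠ m in UU, (hval (z q) (w q) m).1 = FF (code n (e, q)) m := by
    intro q
    by_contra hh
    exact hzw q (UU_not.2 hh)
  have h2 : ∀ᶠ m in UU, FF (code n (e, q)) m ≠ FF (code n (e, q')) m := by
    refine FF_ne fun h => hne ?_
    have := code_inj n h
    simpa using this
  have h3 := h1 q
  rw [heq.1, heq.2] at h3
  obtain ⟨m, m1, m2, m3⟩ := (h2.and (h3.and (h1 q'))).exists
  exact m1 (m2.symm.trans m3)

/-- Fresh colours. -/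
noncomputable def fresh {n : ℕ} (e : Sym2 (Pt n)) (m : ℕ) : Finset ℕ :=
  FF (code n (e, (exists_q e).choose)) m

open Classical in
/-- The colour of a pair of points. -/
noncomputable def col {n : ℕ} (u v : Pt n) : ℕ → Col :=
  if Child v u then hval u v else if Child u v then hval v u else fun m => (fresh s(u, v) m, 0)

lemma col_symm {n : ℕ} (u v : Pt n) : col u v = col v u := by
  by_cases h : Child v u
  · simp [col, h, h.asymm]
  · by_cases h' : Child u v
    · simp [col, h', h]
    · simp [col, h', h, Sym2.eq_swap]

lemma col_child {n : ℕ} {u v : Pt n} (h : Child v u) : col u v = hval u v := by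
  simp [col, h]

lemma col_fresh {n : ℕ} {u v : Pt n} (h : ¬ Child v u) (h' : ¬ Child u v) (m : ℕ) :
    (col u v m).1 = fresh s(u, v) m := by
  simp [col, h, h']

lemma col_L2 {n : ℕ} {a b c : Pt n} (h : ¬ Child a b) (h' : ¬ Child b a) (hc : Child c a) :
    ∀ᶠ m in UU, (col a b m).1 ≠ (col a c m).1 := by
  have := (exists_q s(a, b)).choose_spec a (by simp) c hc
  filter_upwards [this] with m hm
  rw [col_fresh h' h, col_child hc]
  exact fun h => hm h.symm

lemma col_L3 {n : ℕ} {a b c d : Pt n} (h : ¬ Child a b) (h' : ¬ Child b a)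
    (g : ¬ Child c d) (g' : ¬ Child d c) (hne : s(a, b) ≠ s(c, d)) :
    ∀ᶠ m in UU, (col a b m).1 ≠ (col c d m).1 := by
  simp only [col_fresh h' h, col_fresh g' g]
  refine FF_ne fun h => hne ?_
  have := code_inj n h
  simp only [Prod.mk.injEq] at this
  exact this.1

open Classical in
/-- The label of a pair of points. -/
noncomputable def lam {n : ℕ} (a b : Pt n) (m : ℕ) : Option Col :=
  if a = b then none else some (col a b m)

@[simp] lemma lam_self {n : ℕ} (a : Pt n) (m : ℕ) : lam a a m = none := by simp [lam]

lemma lam_ne {n : ℕ} {a b : Pt n} (h : a ≠ b) (m : ℕ) : lam a b m = some (col a b m) := by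
  simp [lam, h]

lemma lam_none {n : ℕ} {a b : Pt n} {m : ℕ} (h : lam a b m = none) : a = b := by
  by_contra hne
  simp [lam_ne hne] at h

lemma lam_some {n : ℕ} {a b : Pt n} {m : ℕ} {c : Col} (h : lam a b m = some c) :
    a ≠ b ∧ col a b m = c := by
  have hne : a ≠ b := by rintro rfl; simp at h
  rw [lam_ne hne] at h
  exact ⟨hne, Option.some.inj h⟩

lemma lam_symm {n : ℕ} (a b : Pt n) (m : ℕ) : lam a b m = lam b a m := by
  by_cases h : a = b
  · rw [h]
  · rw [lam_ne h, lam_ne (Ne.symm h), col_symm]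

/-- The network of a tuple of points. -/
noncomputable def Lam {n : ℕ} (s : Fin n → Pt n) (m : ℕ) : Net n := fun i j =>
  lam (s i) (s j) m

/-- Hereditarily good points. -/
inductive HG {n : ℕ} : Pt n → Prop
  | leaf : HG .leaf
  | node (i : Fin n) (W : Fin n → Pt n) (h : Fin n → ℕ → Col) (hW : ∀ j, j ≠ i → HG (W j))
      (hy : ∀ᶠ m in UU, ∃ y : Net n, Valid m y ∧ (∀ j, j ≠ i → y i j = some (h j m)) ∧
        ∀ j k, j ≠ i → k ≠ i → y j k = Lam W m j k) : HG (.node i W h)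

lemma Lam_symm {n : ℕ} (s : Fin n → Pt n) (m : ℕ) (i j : Fin n) : Lam s m i j = Lam s m j i :=
  lam_symm _ _ _

lemma Lam_upd {n : ℕ} (s : Fin n → Pt n) (m : ℕ) (i : Fin n) (u : Pt n) (j k : Fin n)
    (hj : j ≠ i) (hk : k ≠ i) : Lam (Function.update s i u) m j k = Lam s m j k := by
  simp [Lam, hj, hk]

/-- A network is determined by its row `i` and the rest. -/
lemma net_ext {n m : ℕ} {s : Fin n → Pt n} {u : Pt n} {y : Net n} (i : Fin n) (hy : Valid m y)
    (h1 : ∀ j, j ≠ i → Lam (Function.update s i u) m i j = y i j)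
    (h2 : ∀ j k, j ≠ i → k ≠ i → y j k = Lam s m j k) :
    Lam (Function.update s i u) m = y := by
  funext j k
  by_cases hj : j = i
  · subst hj
    by_cases hk : k = j
    · subst hk; simp [Lam, hy.diag]
    · exact h1 k hk
  · by_cases hk : k = i
    · subst hk
      rw [Lam_symm, hy.symm]; exact h1 j hj
    · rw [Lam_upd _ _ _ _ _ _ hj hk, h2 j k hj hk]

lemma A0 {n m : ℕ} {i : Fin n} {W : Fin n → Pt n} {h : Fin n → ℕ → Col} {y : Net n}
    (hy : Valid m y) (h1 : ∀ j, j ≠ i → y i j = some (h j m))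
    (h2 : ∀ j k, j ≠ i → k ≠ i → y j k = Lam W m j k) :
    Lam (Function.update W i (.node i W h)) m = y := by
  refine net_ext i hy (fun j hj => ?_) h2
  have hc : Child (W j) (.node i W h) := ⟨j, hj, rfl⟩
  have ex : ∃ k, k ≠ i ∧ W k = W j := ⟨j, hj, rfl⟩
  simp only [Lam, Function.update_self, Function.update_of_ne hj]
  rw [lam_ne hc.ne.symm, col_child hc]
  have e : hval (.node i W h) (W j) = h ex.choose := by simp [hval, ex]
  rw [e, ← h1 _ ex.choose_spec.1]
  have : y ex.choose j = none := by
    rw [h2 _ _ ex.choose_spec.1 hj]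
    simp [Lam, ex.choose_spec.2]
  rw [hy.symm i, hy.symm i]
  exact hy.congr _ _ _ this

lemma A0' {n : ℕ} {i : Fin n} {W : Fin n → Pt n} {h : Fin n → ℕ → Col}
    (hg : HG (.node i W h)) :
    ∀ᶠ m in UU, Valid m (Lam (Function.update W i (.node i W h)) m) := by
  cases hg with
  | node _ _ _ hW hy =>
    filter_upwards [hy] with m hm
    obtain ⟨y, hv, h1, h2⟩ := hm
    rw [A0 hv h1 h2]; exact hv

lemma col_bound {n : ℕ} {u v : Pt n} (hu : HG u) (hv : HG v) :
    ∀ᶠ m in UU, (col u v m).1 ⊆ Finset.range (m + n) := by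
  have key : ∀ u v : Pt n, HG u → Child v u →
      ∀ᶠ m in UU, (col u v m).1 ⊆ Finset.range (m + n) := by
    intro u v hu hc
    cases u with
    | leaf => exact hc.elim
    | node i W h =>
      have hc' := hc
      obtain ⟨j, hj, rfl⟩ := hc
      filter_upwards [A0' hu] with m hm
      refine hm.bound i j _ ?_
      simp [Lam, hj, lam_ne hc'.ne.symm]
  by_cases h : Child v u
  · exact key u v hu h
  by_cases h' : Child u v
  · rw [col_symm]; exact key v u hv h'
  · refine Eventually.of_forall fun m => ?_
    rw [col_fresh h h']
    intro k hk
    have := FF_lt hk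
    exact Finset.mem_range.2 (by omega)

/-- No monochromatic triangle on three points. -/
def Tri {n : ℕ} (a b c : Pt n) : Prop :=
  ∀ᶠ m in UU, (col a b m).1 ≠ (col a c m).1 ∨ (col a b m).1 ≠ (col b c m).1

lemma Tri.rot1 {n : ℕ} {a b c : Pt n} (h : Tri a b c) : Tri b a c := by
  unfold Tri at *
  rw [col_symm b a]
  filter_upwards [h] with m hm
  tauto

lemma Tri.rot2 {n : ℕ} {a b c : Pt n} (h : Tri a b c) : Tri a c b := by
  unfold Tri at *
  rw [col_symm c b]
  filter_upwards [h] with m hm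
  by_contra hcon
  push Not at hcon
  rcases hm with h | h
  · exact h hcon.1.symm
  · exact h (hcon.1.symm.trans hcon.2)

lemma tri_L1 {n : ℕ} {a b c : Pt n} (ha : HG a) (hb : Child b a) (hc : Child c a)
    (hbc : b ≠ c) : Tri a b c := by
  cases a with
  | leaf => exact hb.elim
  | node i W h =>
    have hb' := hb
    have hc' := hc
    obtain ⟨j, hj, rfl⟩ := hb
    obtain ⟨k, hk, rfl⟩ := hc
    filter_upwards [A0' ha] with m hm
    by_contra hcon
    push Not at hcon
    refine hm.mono i j k _ _ _ ?_ ?_ ?_ hcon.1 hcon.2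
    · simp [Lam, hj, lam_ne hb'.ne.symm]
    · simp [Lam, hk, lam_ne hc'.ne.symm]
    · simp [Lam, hj, hk, lam_ne hbc]

lemma tri_L2 {n : ℕ} {a b c : Pt n} (h : ¬ Child a b) (h' : ¬ Child b a) (hc : Child c a) :
    Tri a b c :=
  (col_L2 h h' hc).mono fun m hm => Or.inl hm

lemma tri_L3 {n : ℕ} {a b c : Pt n} (hab : a ≠ b) (hac : a ≠ c) (hbc : b ≠ c)
    (h : ¬ Child a b) (h' : ¬ Child b a)
    (g : ¬ Child a c) (g' : ¬ Child c a) : Tri a b c := by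
  refine (col_L3 h h' g g' ?_).mono fun m hm => Or.inl hm
  intro h
  rw [Sym2.eq_iff] at h
  tauto

/-- One fresh edge. -/
lemma tri_one {n : ℕ} {a b c : Pt n} (ha : HG a) (hb : HG b) (hc : HG c) (hab : a ≠ b)
    (hac : a ≠ c) (hbc : b ≠ c) (h : ¬ Child a b) (h' : ¬ Child b a) : Tri a b c := by
  by_cases h1 : Child c a
  · exact tri_L2 h h' h1
  by_cases h2 : Child c b
  · exact (tri_L2 h' h h2).rot1
  by_cases h3 : Child a c
  · by_cases h4 : Child b c
    · exact (tri_L1 hc h3 h4 hab).rot1.rot2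
    · exact (tri_L3 hab.symm hbc hac h' h h4 h2).rot1
  · exact tri_L3 hab hac hbc h h' h3 h1

lemma tri_all {n : ℕ} {a b c : Pt n} (ha : HG a) (hb : HG b) (hc : HG c) (hab : a ≠ b)
    (hac : a ≠ c) (hbc : b ≠ c) : Tri a b c := by
  by_cases h1 : ¬ Child a b ∧ ¬ Child b a
  · exact tri_one ha hb hc hab hac hbc h1.1 h1.2
  by_cases h2 : ¬ Child a c ∧ ¬ Child c a
  · exact (tri_one ha hc hb hac hab hbc.symm h2.1 h2.2).rot2
  by_cases h3 : ¬ Child b c ∧ ¬ Child c b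
  · exact (tri_one hb hc ha hbc hab.symm hac.symm h3.1 h3.2).rot2.rot1
  have d1 := @Child.depth_lt n a b
  have d2 := @Child.depth_lt n b a
  have d3 := @Child.depth_lt n a c
  have d4 := @Child.depth_lt n c a
  have d5 := @Child.depth_lt n b c
  have d6 := @Child.depth_lt n c b
  have : (Child b a ∧ Child c a) ∨ (Child a b ∧ Child c b) ∨ (Child a c ∧ Child b c) := by
    by_cases e1 : Child a b <;> by_cases e2 : Child b a <;> by_cases e3 : Child a c <;>
    by_cases e4 : Child c a <;> by_cases e5 : Child b c <;> by_cases e6 : Child c b <;>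
    simp only [e1, e2, e3, e4, e5, e6, not_true, not_false_eq_true, and_self, and_true,
      and_false, or_true, or_false, forall_const] at * <;> omega
  rcases this with h | h | h
  · exact tri_L1 ha h.1 h.2 hbc
  · exact (tri_L1 hb h.1 h.2 hac).rot1
  · exact (tri_L1 hc h.1 h.2 hab).rot1.rot2

/-- The network of a tuple of good points is almost always consistent. -/
lemma Lam_valid {n : ℕ} (s : Fin n → Pt n) (hs : ∀ i, HG (s i)) :
    ∀ᶠ m in UU, Valid m (Lam s m) := by
  have h1 : ∀ᶠ m in UU, ∀ i j, (col (s i) (s j) m).1 ⊆ Finset.range (m + n) :=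
    eventually_all.2 fun i => eventually_all.2 fun j => col_bound (hs i) (hs j)
  have h2 : ∀ᶠ m in UU, ∀ i j k, s i ≠ s j → s i ≠ s k → s j ≠ s k →
      ((col (s i) (s j) m).1 ≠ (col (s i) (s k) m).1 ∨
        (col (s i) (s j) m).1 ≠ (col (s j) (s k) m).1) := by
    refine eventually_all.2 fun i => eventually_all.2 fun j => eventually_all.2 fun k => ?_
    by_cases hij : s i = s j
    · simp [hij]
    by_cases hik : s i = s k
    · simp [hik]
    by_cases hjk : s j = s k
    · simp [hjk]
    exact (tri_all (hs i) (hs j) (hs k) hij hik hjk).mono fun m hm _ _ _ => hm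
  filter_upwards [h1, h2] with m h1 h2
  refine ⟨fun i => by simp [Lam], Lam_symm s m, ?_, ?_, ?_⟩
  · intro i j k h
    have : s i = s j := lam_none h
    simp [Lam, this]
  · intro i j c h
    rw [← (lam_some h).2]
    exact h1 i j
  · intro i j k a b c ha hb hc e1 e2
    obtain ⟨g1, rfl⟩ := lam_some ha
    obtain ⟨g2, rfl⟩ := lam_some hb
    obtain ⟨g3, rfl⟩ := lam_some hc
    rcases h2 i j k g1 g2 g3 with h | h
    · exact h e1
    · exact h e2

lemma extend {n : ℕ} (s : Fin n → Pt n) (hs : ∀ i, HG (s i)) (i : Fin n) (y : ℕ → Net n)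
    (hy : ∀ᶠ m in UU, Valid m (y m))
    (h : ∀ᶠ m in UU, ∀ j k, j ≠ i → k ≠ i → y m j k = Lam s m j k) :
    ∃ u, HG u ∧ ∀ᶠ m in UU, Lam (Function.update s i u) m = y m := by
  by_cases hex : ∃ j, j ≠ i ∧ ∀ᶠ m in UU, y m i j = none
  · obtain ⟨j, hj, hn⟩ := hex
    refine ⟨s j, hs j, ?_⟩
    filter_upwards [hy, h, hn] with m hy h hn
    refine net_ext i hy (fun k hk => ?_) h
    rw [hy.congr i j k hn, h j k hj hk]
    simp [Lam, hk]
  · have hex : ∀ j, j ≠ i → ¬ ∀ᶠ m in UU, y m i j = none := fun j hj h => hex ⟨j, hj, h⟩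
    have hne : ∀ᶠ m in UU, ∀ j, j ≠ i → y m i j ≠ none := by
      refine eventually_all.2 fun j => ?_
      by_cases hj : j = i
      · simp [hj]
      · exact (UU_not.2 (hex j hj)).mono fun m hm _ => hm
    have hw : ∀ᶠ m in UU, ∀ j, j ≠ i → y m i j = some ((y m i j).getD default) := by
      filter_upwards [hne] with m hm j hj
      have := hm j hj
      cases hh : y m i j with
      | none => exact (this hh).elim
      | some c => rfl
    refine ⟨.node i s (fun j m => (y m i j).getD default),
      HG.node _ _ _ (fun j _ => hs j) ?_, ?_⟩
    · filter_upwards [hy, h, hw] with m hy h hw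
      exact ⟨y m, hy, hw, h⟩
    · filter_upwards [hy, h, hw] with m hy h hw
      exact A0 hy hw h

/-- Every sequence of networks is realized. -/
lemma realize {n : ℕ} (x : ∀ m, XX n m) : ∃ s : Fin n → Pt n, (∀ i, HG (s i)) ∧
    ∀ᶠ m in UU, Lam s m = (x m).1 := by
  rcases Nat.eq_zero_or_pos n with rfl | hn
  · exact ⟨fun _ => .leaf, fun _ => .leaf, Eventually.of_forall fun m => by
      funext i; exact i.elim0⟩
  let ρ : ℕ → Fin n → Fin n := fun j i => if i.1 < j then i else ⟨0, hn⟩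
  have key : ∀ j ≤ n, ∃ s : Fin n → Pt n, (∀ i, HG (s i)) ∧
      ∀ᶠ m in UU, Lam s m = pull (x m).1 (ρ j) := by
    intro j
    induction j with
    | zero =>
      intro _
      refine ⟨fun _ => .leaf, fun _ => .leaf, Eventually.of_forall fun m => ?_⟩
      funext i k
      simp [Lam, pull, ρ, (x m).2.diag]
    | succ j ih =>
      intro hj
      obtain ⟨s, hs, hL⟩ := ih (by omega)
      obtain ⟨u, hu, hL'⟩ := extend s hs ⟨j, hj⟩ (fun m => pull (x m).1 (ρ (j + 1)))
        (Eventually.of_forall fun m => (x m).2.pull _) (by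
          filter_upwards [hL] with m hm k l hk hl
          rw [hm]
          have e : ∀ k : Fin n, k ≠ ⟨j, hj⟩ → ρ (j + 1) k = ρ j k := by
            intro k hk
            have : k.1 ≠ j := fun h => hk (Fin.ext h)
            have e2 : (k.1 < j + 1) ↔ k.1 < j := by omega
            simp only [ρ, e2]
          simp only [pull, e k hk, e l hl])
      refine ⟨_, fun i => ?_, hL'⟩
      by_cases hi : i = ⟨j, hj⟩
      · rw [hi]; simpa using hu
      · simpa [hi] using hs i
  obtain ⟨s, hs, hL⟩ := key n le_rfl
  refine ⟨s, hs, ?_⟩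
  filter_upwards [hL] with m hm
  rw [hm]
  funext i k
  simp [pull, ρ]

/-- The base of the limit representation. -/
abbrev UB (n : ℕ) := {u : Pt n // HG u}

/-- The network of a tuple in the base. -/
noncomputable def Lb {n : ℕ} (s : Fin n → UB n) (m : ℕ) : Net n := Lam (fun i => (s i).1) m

lemma Lb_upd {n : ℕ} (s : Fin n → UB n) (i : Fin n) (u : UB n) (m : ℕ) :
    Lb (Function.update s i u) m = Lam (Function.update (fun i => (s i).1) i u.1) m := by
  unfold Lb
  congr 1
  funext k
  by_cases hk : k = i
  · subst hk; simp
  · simp [hk]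

/-- The limit assignment. -/
noncomputable def lift {n : ℕ} (v : ∀ m, Set (XX n m)) : Set (Fin n → UB n) :=
  {s | ∀ᶠ m in UU, ∃ h : Valid m (Lb s m), (⟨Lb s m, h⟩ : XX n m) ∈ v m}

lemma Lb_valid {n : ℕ} (s : Fin n → UB n) : ∀ᶠ m in UU, Valid m (Lb s m) :=
  Lam_valid _ fun i => (s i).2

lemma limit {n : ℕ} (v : ∀ m, ℕ → Set (XX n m)) (t : CpTerm n) :
    fev (fun l => lift (fun m => v m l)) t = lift (fun m => bev (v m) t) := by
  induction t with
  | var l => rfl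
  | meet t u iht ihu =>
    have : fev (fun l => lift (fun m => v m l)) (.meet t u) =
      fev (fun l => lift (fun m => v m l)) t ∩ fev (fun l => lift (fun m => v m l)) u := rfl
    rw [this, iht, ihu]
    ext s
    constructor
    · rintro ⟨h1, h2⟩
      filter_upwards [h1, h2] with m ⟨h, h1⟩ ⟨_, h2⟩
      exact ⟨h, h1, h2⟩
    · intro h
      exact ⟨h.mono fun m ⟨h, h1⟩ => ⟨h, h1.1⟩, h.mono fun m ⟨h, h1⟩ => ⟨h, h1.2⟩⟩
  | compl t ih =>
    have : fev (fun l => lift (fun m => v m l)) (.compl t) =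
      (fev (fun l => lift (fun m => v m l)) t)ᶜ := rfl
    rw [this, ih]
    ext s
    constructor
    · intro h
      filter_upwards [UU_not.2 h, Lb_valid s] with m h1 h2
      exact ⟨h2, fun h3 => h1 ⟨h2, h3⟩⟩
    · intro h
      refine UU_not.1 ?_
      filter_upwards [h] with m ⟨h1, h2⟩ ⟨_, h3⟩
      exact h2 h3
  | cyl i t ih =>
    have : fev (fun l => lift (fun m => v m l)) (.cyl i t) =
      Cyl i (fev (fun l => lift (fun m => v m l)) t) := rfl
    rw [this, ih]
    ext s
    constructor
    · rintro ⟨u, h⟩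
      filter_upwards [h, Lb_valid s] with m ⟨h1, h2⟩ h3
      refine ⟨h3, ⟨_, h1⟩, h2, fun j k hj hk => ?_⟩
      change Lb (Function.update s i u) m j k = Lb s m j k
      rw [Lb_upd, Lam_upd _ _ _ _ _ _ hj hk]
      rfl
    · intro h
      have h' : ∀ᶠ m in UU, ∃ y : Net n, ∃ hy : Valid m y, (⟨y, hy⟩ : XX n m) ∈ bev (v m) t ∧
          ∀ j k, j ≠ i → k ≠ i → y j k = Lb s m j k := by
        filter_upwards [h] with m ⟨h1, y, hy, h2⟩
        exact ⟨y.1, y.2, hy, h2⟩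
      obtain ⟨y, hy⟩ := h'.choice
      obtain ⟨u, hu, hL⟩ := extend (fun i => (s i).1) (fun i => (s i).2) i y
        (hy.mono fun m ⟨h, _⟩ => h) (hy.mono fun m ⟨_, _, h⟩ => h)
      refine ⟨⟨u, hu⟩, ?_⟩
      filter_upwards [hy, hL] with m ⟨h1, h2, _⟩ h3
      have e : Lb (Function.update s i ⟨u, hu⟩) m = y m := by rw [Lb_upd, h3]
      have e2 : Valid m (Lb (Function.update s i ⟨u, hu⟩) m) := e ▸ h1
      refine ⟨e2, ?_⟩
      have e3 : (⟨_, e2⟩ : XX n m) = ⟨y m, h1⟩ := Subtype.ext e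
      rw [e3]; exact h2
  | perm i j t ih =>
    have : fev (fun l => lift (fun m => v m l)) (.perm i j t) =
      Transp i j (fev (fun l => lift (fun m => v m l)) t) := rfl
    rw [this, ih]
    ext s
    have e : s ∈ Transp i j (lift (fun m => bev (v m) t)) ↔
        (fun k => s (Equiv.swap i j k)) ∈ lift (fun m => bev (v m) t) := by
      rw [← upd_swap]; rfl
    rw [e]
    have e2 : ∀ m, Lb (fun k => s (Equiv.swap i j k)) m = pull (Lb s m) (Equiv.swap i j) :=
      fun m => rfl
    constructor
    · intro h
      filter_upwards [h, Lb_valid s] with m ⟨h1, h2⟩ h3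
      exact ⟨h3, h2⟩
    · intro h
      filter_upwards [h] with m ⟨h1, h2⟩
      exact ⟨h1.pull _, h2⟩

lemma not_cofinal {n : ℕ} (e : CpTerm n × CpTerm n)
    (he : ∀ U : Type, (fullCp n U).Satisfies e)
    (hne : ∀ᶠ m in UU, ¬ (BB n m).Satisfies e) : False := by
  have h1 : ∀ m, ∃ v : ℕ → Set (XX n m), ∃ x : XX n m,
      ¬ (BB n m).Satisfies e → ¬ (x ∈ bev v e.1 ↔ x ∈ bev v e.2) := by
    intro m
    by_cases h : (BB n m).Satisfies e
    · exact ⟨fun _ => ∅, ⟨_, valid_none⟩, fun h' => (h' h).elim⟩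
    · have h' : ¬ ∀ v : ℕ → Set (XX n m), bev v e.1 = bev v e.2 := h
      push Not at h'
      obtain ⟨v, hv⟩ := h'
      by_contra hcon
      push Not at hcon
      exact hv (Set.ext fun x => (hcon v x).2)
  choose v x hx using h1
  obtain ⟨s, hs, hL⟩ := realize x
  let r : Fin n → UB n := fun i => ⟨s i, hs i⟩
  have e1 : fev (fun l => lift (fun m => v m l)) e.1 = fev (fun l => lift (fun m => v m l)) e.2 :=
    he (UB n) _
  rw [limit, limit] at e1
  have key : ∀ t, r ∈ lift (fun m => bev (v m) t) ↔ ∀ᶠ m in UU, x m ∈ bev (v m) t := by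
    intro t
    have hL' : ∀ᶠ m in UU, ((∃ h : Valid m (Lb r m), (⟨Lb r m, h⟩ : XX n m) ∈ bev (v m) t) ↔
        x m ∈ bev (v m) t) := by
      filter_upwards [hL] with m hm
      have hm : Lb r m = (x m).1 := hm
      constructor
      · rintro ⟨h, h2⟩
        have : (⟨Lb r m, h⟩ : XX n m) = x m := Subtype.ext hm
        rwa [this] at h2
      · intro h
        have h' : Valid m (Lb r m) := hm ▸ (x m).2
        refine ⟨h', ?_⟩
        have : (⟨Lb r m, h'⟩ : XX n m) = x m := Subtype.ext hm
        rwa [this]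
    exact eventually_congr hL'
  have hr : (∀ᶠ m in UU, x m ∈ bev (v m) e.1) ↔ ∀ᶠ m in UU, x m ∈ bev (v m) e.2 := by
    rw [← key, ← key, e1]
  by_cases h : ∀ᶠ m in UU, x m ∈ bev (v m) e.1
  · obtain ⟨m, m1, m2, m3⟩ := (h.and ((hr.1 h).and hne)).exists
    exact hx m m3 (iff_of_true m1 m2)
  · obtain ⟨m, m1, m2, m3⟩ := ((UU_not.2 h).and ((UU_not.2 (fun h' => h (hr.2 h'))).and hne)).exists
    exact hx m m3 (iff_of_false m1 m2)

end CpProof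

/-- Theorem 2(ii): for `3 ≤ n < ω`, the class `RA^cp_n` is not finitely axiomatizable
over `RA^p_n`: there is no finite set `E` of cp-type equations such that an algebra of
the cp type satisfies `E` together with every p-type equation valid in all full p set
algebras iff it satisfies every cp-type equation valid in all full cp set algebras. -/
theorem cp_not_finitely_axiomatizable_over_p (n : ℕ) (hn : 3 ≤ n) :
    ¬ ∃ E : Set (CpTerm n × CpTerm n), E.Finite ∧
      ∀ B : CpAlg n,
        ((∀ e ∈ E, B.Satisfies e) ∧
         (∀ e : PTerm n × PTerm n,
            (∀ U : Type, (fullP n U).Satisfies e) → B.pReduct.Satisfies e))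
        ↔ (∀ e : CpTerm n × CpTerm n,
            (∀ U : Type, (fullCp n U).Satisfies e) → B.Satisfies e) := by
  rintro ⟨E, hfin, hE⟩
  have hval : ∀ e ∈ E, ∀ U : Type, (fullCp n U).Satisfies e := by
    intro e he U
    exact ((hE (fullCp n U)).2 (fun e he => he U)).1 e he
  have hbad : ∀ m, ∃ e ∈ E, ¬ (CpProof.BB n m).Satisfies e := by
    intro m
    by_contra hcon
    push Not at hcon
    obtain ⟨e, he, hne⟩ := CpProof.BB_not_rep n m hn
    exact hne ((hE (CpProof.BB n m)).1 ⟨hcon, fun e he => CpProof.BB_p n m e he⟩ e he)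
  have : ∃ e ∈ E, ∀ᶠ m in CpProof.UU, ¬ (CpProof.BB n m).Satisfies e := by
    by_contra hcon
    push Not at hcon
    have h : ∀ᶠ m in CpProof.UU, ∀ e ∈ E, (CpProof.BB n m).Satisfies e := by
      refine (Filter.eventually_all_finite hfin).2 fun e he => ?_
      by_contra hh
      exact hcon e he (CpProof.UU_not.2 hh)
    obtain ⟨m, hm⟩ := h.exists
    obtain ⟨e, he, hne⟩ := hbad m
    exact hne (hm e he)
  obtain ⟨e, he, hne⟩ := this
  exact CpProof.not_cofinal e (hval e he) hne
end
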